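/- Let (X,T) be a topological dynamical system, ℰ : M(X) → ℝ an energy, and 𝒰 a finite open cover of X. Then for every ergodic T-invariant Borel probability measure μ, h_μ(T,𝒰) + ℰ(μ) ≤ liminf_{n→∞} (1/n) log p_n(T,ℰ;𝒰), where p_n(T,ℰ;𝒰) = inf { ∑_{V∈𝒱} sup_{x∈V} e^{nℰ(Δ_x^n)} : 𝒱 a finite Borel cover refining 𝒰_0^{n-1} }. -/

import Mathlib

open MeasureTheory Filter Set
open scoped ENNReal NNReal Classical

set_option linter.unusedSectionVars false

variable {X : Type*} [MetricSpace X] [CompactSpace X] [MeasurableSpace X] [BorelSpace X]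

/-- The empirical measure `Δ_x^n = (1/n) ∑_{i<n} δ_{T^i x}` as a `Measure`. -/
noncomputable def empMeas (T : X → X) (n : ℕ) (x : X) : Measure X :=
  (n : ℝ≥0∞)⁻¹ • ∑ i ∈ Finset.range n, Measure.dirac (T^[i] x)

theorem empMeas_prob (T : X → X) {n : ℕ} (hn : n ≠ 0) (x : X) :
    IsProbabilityMeasure (empMeas T n x) := by
  constructor
  simp only [empMeas, Measure.smul_apply, smul_eq_mul, Measure.finset_sum_apply,
    measure_univ, Finset.sum_const, Finset.card_range, nsmul_eq_mul, mul_one]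
  exact ENNReal.inv_mul_cancel (by exact_mod_cast hn) (by simp)

/-- The empirical measure as a probability measure (junk value `δ_x` for `n = 0`). -/
noncomputable def empPM (T : X → X) (n : ℕ) (x : X) : ProbabilityMeasure X :=
  if hn : n = 0 then ⟨Measure.dirac x, inferInstance⟩
  else ⟨empMeas T n x, empMeas_prob T hn x⟩

/-- The weight `e^{n ℰ(Δ_x^n)}`. -/
noncomputable def wt (T : X → X) (ℰ : ProbabilityMeasure X → ℝ) (n : ℕ) (x : X) : ℝ :=
  Real.exp (n * ℰ (empPM T n x))

/-- Kantorovich–Rubinstein (Wasserstein-1) distance. -/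
noncomputable def Wass (μ ν : Measure X) : ℝ :=
  sSup {r | ∃ g : X → ℝ, LipschitzWith 1 g ∧ r = (∫ x, g x ∂μ) - ∫ x, g x ∂ν}

/-- The dynamical join `𝒰_0^{n-1} = ⋁_{i=0}^{n-1} T^{-i} 𝒰`. -/
noncomputable def joinF (T : X → X) (𝒰 : Finset (Set X)) (n : ℕ) : Finset (Set X) :=
  (Fintype.piFinset fun _ : Fin n => 𝒰).image fun u => ⋂ i : Fin n, T^[(i : ℕ)] ⁻¹' u i

def IsBorelCover (𝒱 : Finset (Set X)) : Prop :=
  (∀ V ∈ 𝒱, MeasurableSet V) ∧ ⋃₀ (𝒱 : Set (Set X)) = univ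

def IsOpenCover (𝒰 : Finset (Set X)) : Prop :=
  (∀ U ∈ 𝒰, IsOpen U) ∧ ⋃₀ (𝒰 : Set (Set X)) = univ

/-- `𝒱` refines `𝒲`: every element of `𝒱` is contained in some element of `𝒲`. -/
def Refines (𝒱 𝒲 : Finset (Set X)) : Prop := ∀ V ∈ 𝒱, ∃ W ∈ 𝒲, V ⊆ W

def IsPartitionF (α : Finset (Set X)) : Prop :=
  (∀ A ∈ α, MeasurableSet A) ∧ ⋃₀ (α : Set (Set X)) = univ ∧
    ∀ A ∈ α, ∀ B ∈ α, A ≠ B → Disjoint A B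

noncomputable def p1 (T : X → X) (ℰ : ProbabilityMeasure X → ℝ) (𝒰 : Finset (Set X)) (n : ℕ) : ℝ :=
  sInf {r | ∃ 𝒱 : Finset (Set X), IsBorelCover 𝒱 ∧ Refines 𝒱 (joinF T 𝒰 n) ∧
    r = ∑ V ∈ 𝒱, sSup (wt T ℰ n '' V)}

noncomputable def p2 (T : X → X) (ℰ : ProbabilityMeasure X → ℝ) (𝒰 : Finset (Set X)) (n : ℕ) : ℝ :=
  sInf {r | ∃ 𝒱 : Finset (Set X), IsBorelCover 𝒱 ∧ Refines 𝒱 (joinF T 𝒰 n) ∧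
    r = ∑ V ∈ 𝒱, sInf (wt T ℰ n '' V)}

noncomputable def p3 (T : X → X) (ℰ : ProbabilityMeasure X → ℝ) (𝒰 : Finset (Set X)) (n : ℕ) : ℝ :=
  sInf {r | ∃ β : Finset (Set X), β ⊆ joinF T 𝒰 n ∧ ⋃₀ (β : Set (Set X)) = univ ∧
    r = ∑ B ∈ β, sSup (wt T ℰ n '' B)}

noncomputable def p4 (T : X → X) (ℰ : ProbabilityMeasure X → ℝ) (𝒰 : Finset (Set X)) (n : ℕ) : ℝ :=
  sInf {r | ∃ β : Finset (Set X), β ⊆ joinF T 𝒰 n ∧ ⋃₀ (β : Set (Set X)) = univ ∧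
    r = ∑ B ∈ β, sInf (wt T ℰ n '' B)}

/-- `E` is an `(n,ε)`-separated set. -/
def IsSeparated (T : X → X) (n : ℕ) (ε : ℝ) (E : Finset X) : Prop :=
  ∀ x ∈ E, ∀ y ∈ E, x ≠ y → ∃ i < n, ε ≤ dist (T^[i] x) (T^[i] y)

/-- `F` is an `(n,ε)`-spanning set. -/
def IsSpanning (T : X → X) (n : ℕ) (ε : ℝ) (F : Finset X) : Prop :=
  ∀ x : X, ∃ y ∈ F, ∀ i < n, dist (T^[i] x) (T^[i] y) < ε

noncomputable def Pn (T : X → X) (ℰ : ProbabilityMeasure X → ℝ) (n : ℕ) (ε : ℝ) : ℝ :=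
  sSup {r | ∃ E : Finset X, IsSeparated T n ε E ∧ r = ∑ x ∈ E, wt T ℰ n x}

noncomputable def Qn (T : X → X) (ℰ : ProbabilityMeasure X → ℝ) (n : ℕ) (ε : ℝ) : ℝ :=
  sInf {r | ∃ F : Finset X, IsSpanning T n ε F ∧ r = ∑ x ∈ F, wt T ℰ n x}

/-- `τ_ε`, modulus of continuity of the energy w.r.t. the Wasserstein distance. -/
noncomputable def tauE (ℰ : ProbabilityMeasure X → ℝ) (ε : ℝ) : ℝ :=
  sSup {r | ∃ μ ν : ProbabilityMeasure X, Wass (μ : Measure X) (ν : Measure X) ≤ ε ∧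
    r = |ℰ μ - ℰ ν|}

/-- Shannon entropy of a finite collection of sets. -/
noncomputable def entF (μ : Measure X) (α : Finset (Set X)) : ℝ :=
  ∑ A ∈ α, Real.negMulLog (μ A).toReal

/-- `H_μ(𝒰)`: infimum of entropies of partitions refining `𝒰`. -/
noncomputable def Hcov (μ : Measure X) (𝒰 : Finset (Set X)) : ℝ :=
  sInf {r | ∃ α : Finset (Set X), IsPartitionF α ∧ Refines α 𝒰 ∧ r = entF μ α}

/-- Local measure-theoretic entropy `h_μ(T,𝒰)`. -/
noncomputable def hcov (T : X → X) (μ : Measure X) (𝒰 : Finset (Set X)) : ℝ :=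
  Filter.atTop.limsup fun n => Hcov μ (joinF T 𝒰 n) / n


/-- The mean ergodic theorem for an ergodic map: Birkhoff averages of a square-integrable function
converge in measure to its integral. -/
theorem Ergodic.tendstoInMeasure_birkhoffAverage {Ω : Type*} [MeasurableSpace Ω] {m : Measure Ω}
    [IsProbabilityMeasure m] {S : Ω → Ω} (hS : Ergodic S m) {f : Ω → ℝ} (hf : MemLp f 2 m) :
    TendstoInMeasure m (fun n => birkhoffAverage ℝ S f n) atTop fun _ => ∫ x, f x ∂m := by
  set U : Lp ℝ 2 m →L[ℝ] Lp ℝ 2 m :=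
    (Lp.compMeasurePreservingₗᵢ ℝ S hS.toMeasurePreserving).toContinuousLinearMap
  have hnorm : ‖U‖ ≤ 1 := LinearIsometry.norm_toContinuousLinearMap_le _
  set P := (U.eqLocus (1 : Lp ℝ 2 m →L[ℝ] Lp ℝ 2 m)).orthogonalProjectionOnto (hf.toLp f)
  have hlim := tendstoInMeasure_of_tendsto_Lp
    (U.tendsto_birkhoffAverage_orthogonalProjection hnorm (hf.toLp f))
  have hfix : Lp.compMeasurePreserving S hS.toMeasurePreserving (P : Lp ℝ 2 m) = P := P.2
  have hinv : (P : Lp ℝ 2 m) ∘ S =ᵐ[m] (P : Lp ℝ 2 m) := by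
    have h := Lp.coeFn_compMeasurePreserving (P : Lp ℝ 2 m) hS.toMeasurePreserving
    rw [hfix] at h
    exact h.symm
  obtain ⟨c, hc⟩ := hS.ae_eq_const_of_ae_eq_comp_ae (Lp.aestronglyMeasurable _) hinv
  have hone : indicatorConstLp 2 MeasurableSet.univ (measure_ne_top m univ) (1 : ℝ) ∈
      U.eqLocus (1 : Lp ℝ 2 m →L[ℝ] Lp ℝ 2 m) := by
    change Lp.compMeasurePreserving S hS.toMeasurePreserving _ = _
    rw [Lp.indicatorConstLp_compMeasurePreserving]
    rfl
  have hcint : c = ∫ x, f x ∂m := by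
    have h1 := Submodule.inner_orthogonalProjectionOnto_eq_of_mem_left ⟨_, hone⟩ (hf.toLp f)
    rw [Submodule.coe_inner, L2.inner_indicatorConstLp_one, L2.inner_indicatorConstLp_one,
      Measure.restrict_univ, integral_congr_ae hc, integral_congr_ae hf.coeFn_toLp] at h1
    simpa using h1
  refine hlim.congr (fun n => ?_) (hc.trans (by rw [hcint]; rfl))
  have hiter : ∀ k, (U^[k] (hf.toLp f) : Ω → ℝ) =ᵐ[m] f ∘ S^[k] := by
    intro k
    have hk := hS.toMeasurePreserving.iterate k
    have h : U^[k] (hf.toLp f) = (hf.comp_measurePreserving hk).toLp _ := by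
      rw [← Lp.toLp_compMeasurePreserving hf hk, ← Lp.compMeasurePreserving_iterate]
      rfl
    rw [h]
    exact MemLp.coeFn_toLp (hf.comp_measurePreserving hk)
  simp only [birkhoffAverage, birkhoffSum, id]
  refine (Lp.coeFn_smul _ _).trans ?_
  have hsum := Lp.coeFn_finsetSum (Finset.range n) fun k => U^[k] (hf.toLp f)
  filter_upwards [hsum, ae_all_iff.2 hiter] with x hx hk
  simp only [Pi.smul_apply, hx, Finset.sum_apply, smul_eq_mul, birkhoffAverage, birkhoffSum]
  congr 1
  exact Finset.sum_congr rfl fun k _ => hk k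

/-- The filter on `ℕ × Ω` describing convergence in measure as the first coordinate tends to
infinity. -/
def inMeasureFilter {Ω : Type*} [MeasurableSpace Ω] (m : Measure Ω) : Filter (ℕ × Ω) where
  sets := {S | Tendsto (fun n => m {x | (n, x) ∉ S}) atTop (nhds 0)}
  univ_sets := by simp
  sets_of_superset := by
    intro S S' hS hSS'
    exact tendsto_of_tendsto_of_tendsto_of_le_of_le tendsto_const_nhds hS (fun _ => zero_le)
      fun n => measure_mono fun x hx hxS => hx (hSS' hxS)
  inter_sets := by
    intro S S' hS hS'
    have h : Tendsto (fun n => m {x | (n, x) ∉ S} + m {x | (n, x) ∉ S'}) atTop (nhds 0) := by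
      simpa using Tendsto.add (show Tendsto _ _ _ from hS) (show Tendsto _ _ _ from hS')
    refine tendsto_of_tendsto_of_tendsto_of_le_of_le tendsto_const_nhds h (fun _ => zero_le)
      fun n => ?_
    refine (measure_mono fun x hx => ?_).trans (measure_union_le _ _)
    by_contra hcon
    simp only [mem_union, mem_ofPred_eq, not_or, not_not] at hcon
    exact hx hcon

theorem mem_inMeasureFilter {Ω : Type*} [MeasurableSpace Ω] {m : Measure Ω} {S : Set (ℕ × Ω)} :
    S ∈ inMeasureFilter m ↔ Tendsto (fun n => m {x | (n, x) ∉ S}) atTop (nhds 0) :=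
  Iff.rfl

theorem integral_empPM (T : X → X) {n : ℕ} (hn : n ≠ 0) (x : X)
    (f : BoundedContinuousFunction X ℝ) :
    ∫ y, f y ∂(empPM T n x : Measure X) = birkhoffAverage ℝ T f n x := by
  have h : (empPM T n x : Measure X) = empMeas T n x :=
    congrArg (fun ν : ProbabilityMeasure X => (ν : Measure X)) (dif_neg hn)
  rw [h, empMeas, integral_smul_measure, integral_finsetSum_measure]
  · simp [birkhoffAverage, birkhoffSum]
  · intro i _
    exact f.integrable _

theorem continuous_empPM {T : X → X} (hT : Continuous T) (n : ℕ) : Continuous (empPM T n) := by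
  rw [continuous_iff_continuousAt]
  intro x
  rw [ContinuousAt, ProbabilityMeasure.tendsto_iff_forall_integral_tendsto]
  intro f
  by_cases hn : n = 0
  · have h : ∀ y, ∫ z, f z ∂(empPM T n y : Measure X) = f y := by
      intro y
      have h : (empPM T n y : Measure X) = Measure.dirac y :=
        congrArg (fun ν : ProbabilityMeasure X => (ν : Measure X)) (dif_pos hn)
      rw [h, integral_dirac]
    simp only [h]
    exact f.continuous.tendsto x
  · simp only [integral_empPM T hn, birkhoffAverage, birkhoffSum]
    refine Continuous.tendsto (f := fun y => (n : ℝ)⁻¹ • ∑ k ∈ Finset.range n, f (T^[k] y)) ?_ x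
    exact (continuous_const (y := (n : ℝ)⁻¹)).smul
      (continuous_finsetSum _ fun k _ => f.continuous.comp (hT.iterate k))

theorem tendsto_empPM_inMeasureFilter {T : X → X} {μ : ProbabilityMeasure X}
    (herg : Ergodic T (μ : Measure X)) :
    Tendsto (fun p : ℕ × X => empPM T p.1 p.2) (inMeasureFilter (μ : Measure X)) (nhds μ) := by
  rw [ProbabilityMeasure.tendsto_iff_forall_integral_tendsto]
  intro f
  have hf : MemLp f 2 (μ : Measure X) :=
    MemLp.of_bound f.continuous.aestronglyMeasurable ‖f‖ (ae_of_all _ f.norm_coe_le_norm)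
  have h := tendstoInMeasure_iff_dist.1 (herg.tendstoInMeasure_birkhoffAverage hf)
  rw [Metric.tendsto_nhds]
  intro ε hε
  refine mem_inMeasureFilter.2 ((h ε hε).congr' ?_)
  filter_upwards [eventually_ne_atTop 0] with n hn
  congr 1
  ext x
  simp only [mem_ofPred_eq, integral_empPM T hn, not_lt]

theorem exists_abs_energy_le {ℰ : ProbabilityMeasure X → ℝ} (hE : Continuous ℰ) :
    ∃ M, 0 ≤ M ∧ ∀ ν, |ℰ ν| ≤ M := by
  obtain ⟨M, hM⟩ := isCompact_univ.exists_bound_of_continuousOn hE.continuousOn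
  exact ⟨max M 0, le_max_right _ _, fun ν => (hM ν (mem_univ _)).trans (le_max_left _ _)⟩

theorem integrable_energy_empPM {T : X → X} (hT : Continuous T) {ℰ : ProbabilityMeasure X → ℝ}
    (hE : Continuous ℰ) (μ : ProbabilityMeasure X) (n : ℕ) :
    Integrable (fun x => ℰ (empPM T n x)) (μ : Measure X) := by
  obtain ⟨M, -, hM⟩ := exists_abs_energy_le hE
  exact Integrable.of_bound (hE.comp (continuous_empPM hT n)).aestronglyMeasurable M
    (ae_of_all _ fun x => hM _)

/-- The mean energy of the empirical measures is asymptotically at least the energy of the ergodic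
measure. -/
theorem eventually_le_integral_energy {T : X → X} (hT : Continuous T)
    {ℰ : ProbabilityMeasure X → ℝ} (hE : Continuous ℰ) {μ : ProbabilityMeasure X}
    (herg : Ergodic T (μ : Measure X)) {ε : ℝ} (hε : 0 < ε) :
    ∀ᶠ n in atTop, ℰ μ - ε ≤ ∫ x, ℰ (empPM T n x) ∂(μ : Measure X) := by
  obtain ⟨M, hM0, hM⟩ := exists_abs_energy_le hE
  have hmem : {p : ℕ × X | ℰ μ - ε / 2 < ℰ (empPM T p.1 p.2)} ∈ inMeasureFilter (μ : Measure X) :=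
    ((hE.tendsto μ).comp (tendsto_empPM_inMeasureFilter herg)).eventually
      (lt_mem_nhds (by linarith))
  have hbad : Tendsto (fun n => (μ : Measure X).real {x | ℰ (empPM T n x) ≤ ℰ μ - ε / 2}) atTop
      (nhds 0) := by
    have h := mem_inMeasureFilter.1 hmem
    simp only [mem_ofPred_eq, not_lt] at h
    exact (ENNReal.tendsto_toReal ENNReal.zero_ne_top).comp h
  have hsmall := (hbad.const_mul (2 * M)).eventually
    (gt_mem_nhds (show 2 * M * 0 < ε / 2 by linarith))
  filter_upwards [hsmall] with n hn
  have hcont : Continuous fun x => ℰ (empPM T n x) := hE.comp (continuous_empPM hT n)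
  have hmeas : MeasurableSet {x | ℰ (empPM T n x) ≤ ℰ μ - ε / 2} :=
    (isClosed_le hcont continuous_const).measurableSet
  have hint : Integrable ({x | ℰ (empPM T n x) ≤ ℰ μ - ε / 2}.indicator fun _ => 2 * M)
      (μ : Measure X) := (integrable_const _).indicator hmeas
  have hle : ∫ x, ((ℰ μ - ε / 2) -
      {x | ℰ (empPM T n x) ≤ ℰ μ - ε / 2}.indicator (fun _ => 2 * M) x) ∂(μ : Measure X) ≤
      ∫ x, ℰ (empPM T n x) ∂(μ : Measure X) := by
    refine integral_mono ((integrable_const _).sub hint) (integrable_energy_empPM hT hE μ n) ?_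
    intro x
    by_cases hx : x ∈ {x | ℰ (empPM T n x) ≤ ℰ μ - ε / 2}
    · have h1 := abs_le.1 (hM (empPM T n x))
      have h2 := abs_le.1 (hM μ)
      simp only [indicator_of_mem hx]
      linarith
    · simp only [indicator_of_notMem hx]
      simp only [mem_ofPred_eq, not_le] at hx
      linarith
  rw [integral_sub (integrable_const _) hint, integral_indicator_const _ hmeas] at hle
  simp only [integral_const, probReal_univ, smul_eq_mul, one_mul] at hle
  linarith

/-- The finite Gibbs inequality. -/
theorem sum_negMulLog_add_mul_log_le {ι : Type*} [Fintype ι] {b w : ι → ℝ} (hb : ∀ i, 0 ≤ b i)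
    (hsum : ∑ i, b i = 1) (hw : ∀ i, 0 ≤ w i) (hbw : ∀ i, b i ≠ 0 → 0 < w i) :
    ∑ i, (Real.negMulLog (b i) + b i * Real.log (w i)) ≤ Real.log (∑ i, w i) := by
  have hZ : 0 < ∑ i, w i := by
    obtain ⟨i, -, hi⟩ := Finset.exists_ne_zero_of_sum_ne_zero (hsum.trans_ne one_ne_zero)
    exact Finset.sum_pos' (fun i _ => hw i) ⟨i, Finset.mem_univ i, hbw i hi⟩
  set Z := ∑ i, w i with hZdef
  have hterm : ∀ i, Real.negMulLog (b i) + b i * Real.log (w i) ≤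
      w i / Z - b i + b i * Real.log Z := by
    intro i
    rcases (hb i).eq_or_lt with h0 | h0
    · simpa [← h0] using div_nonneg (hw i) hZ.le
    · have hwi := hbw i h0.ne'
      have h := mul_le_mul_of_nonneg_left
        (Real.log_le_sub_one_of_pos (div_pos hwi (mul_pos h0 hZ))) h0.le
      rw [Real.log_div hwi.ne' (mul_pos h0 hZ).ne', Real.log_mul h0.ne' hZ.ne'] at h
      have h2 : b i * (w i / (b i * Z) - 1) = w i / Z - b i := by field_simp
      rw [h2] at h
      rw [Real.negMulLog]
      linarith
  calc ∑ i, (Real.negMulLog (b i) + b i * Real.log (w i))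
      ≤ ∑ i, (w i / Z - b i + b i * Real.log Z) := Finset.sum_le_sum fun i _ => hterm i
    _ = Real.log Z := by
        rw [Finset.sum_add_distrib, Finset.sum_sub_distrib, ← Finset.sum_div, ← Finset.sum_mul,
          hsum, ← hZdef, div_self hZ.ne']
        ring

/-- An indexed measurable partition, possibly with empty members. -/
structure IsMeasurablePartition {Ω ι : Type*} [MeasurableSpace Ω] (B : ι → Set Ω) : Prop where
  measurableSet : ∀ i, MeasurableSet (B i)
  disjoint : Pairwise fun i j => Disjoint (B i) (B j)
  iUnion_eq : ⋃ i, B i = univ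

namespace IsMeasurablePartition

variable {Ω ι κ : Type*} [MeasurableSpace Ω] {B : ι → Set Ω} {C : κ → Set Ω}

theorem preimage (hB : IsMeasurablePartition B) {S : Ω → Ω} (hS : Measurable S) :
    IsMeasurablePartition fun i => S ⁻¹' B i where
  measurableSet i := hS (hB.measurableSet i)
  disjoint _ _ hij := (hB.disjoint hij).preimage S
  iUnion_eq := by rw [← preimage_iUnion, hB.iUnion_eq, preimage_univ]

theorem inter (hB : IsMeasurablePartition B) (hC : IsMeasurablePartition C) :
    IsMeasurablePartition fun p : ι × κ => B p.1 ∩ C p.2 where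
  measurableSet p := (hB.measurableSet p.1).inter (hC.measurableSet p.2)
  disjoint := by
    rintro ⟨i, j⟩ ⟨i', j'⟩ hne
    by_cases hi : i = i'
    · have hj : j ≠ j' := fun hj => hne (by rw [hi, hj])
      exact (hC.disjoint hj).mono inter_subset_right inter_subset_right
    · exact (hB.disjoint hi).mono inter_subset_left inter_subset_left
  iUnion_eq := by
    rw [eq_univ_iff_forall]
    intro x
    obtain ⟨i, hi⟩ := mem_iUnion.1 (hB.iUnion_eq.symm ▸ mem_univ x)
    obtain ⟨j, hj⟩ := mem_iUnion.1 (hC.iUnion_eq.symm ▸ mem_univ x)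
    exact mem_iUnion.2 ⟨(i, j), hi, hj⟩

theorem sum_measureReal_inter [Fintype ι] (hB : IsMeasurablePartition B) (m : Measure Ω)
    [IsFiniteMeasure m] {A : Set Ω} (hA : MeasurableSet A) :
    ∑ i, m.real (A ∩ B i) = m.real A := by
  have h := measureReal_biUnion_finset (μ := m) (s := Finset.univ) (f := fun i => A ∩ B i)
    (fun i _ j _ hij => (hB.disjoint hij).mono inter_subset_right inter_subset_right)
    (fun i _ => hA.inter (hB.measurableSet i))
  rw [← h]
  congr 1
  simp [← inter_iUnion, hB.iUnion_eq]

theorem sum_measureReal [Fintype ι] (hB : IsMeasurablePartition B) (m : Measure Ω)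
    [IsProbabilityMeasure m] : ∑ i, m.real (B i) = 1 := by
  simpa using hB.sum_measureReal_inter m MeasurableSet.univ

/-- Subadditivity of Shannon entropy under joins of partitions. -/
theorem entropy_inter_le [Fintype ι] [Fintype κ] (hB : IsMeasurablePartition B)
    (hC : IsMeasurablePartition C) (m : Measure Ω) [IsProbabilityMeasure m] :
    ∑ p : ι × κ, Real.negMulLog (m.real (B p.1 ∩ C p.2)) ≤
      ∑ i, Real.negMulLog (m.real (B i)) + ∑ j, Real.negMulLog (m.real (C j)) := by
  have hpos : ∀ p : ι × κ, m.real (B p.1 ∩ C p.2) ≠ 0 →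
      0 < m.real (B p.1) ∧ 0 < m.real (C p.2) := by
    intro p hp
    have hp' : 0 < m.real (B p.1 ∩ C p.2) := lt_of_le_of_ne measureReal_nonneg hp.symm
    exact ⟨hp'.trans_le (measureReal_mono inter_subset_left),
      hp'.trans_le (measureReal_mono inter_subset_right)⟩
  have hgibbs := sum_negMulLog_add_mul_log_le
    (b := fun p : ι × κ => m.real (B p.1 ∩ C p.2)) (w := fun p => m.real (B p.1) * m.real (C p.2))
    (fun p => measureReal_nonneg) ((hB.inter hC).sum_measureReal m)
    (fun p => mul_nonneg measureReal_nonneg measureReal_nonneg)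
    (fun p hp => mul_pos (hpos p hp).1 (hpos p hp).2)
  have hw : ∑ p : ι × κ, m.real (B p.1) * m.real (C p.2) = 1 := by
    rw [Fintype.sum_prod_type]
    dsimp only
    rw [← Finset.sum_mul_sum, hB.sum_measureReal, hC.sum_measureReal,
      mul_one]
  rw [hw, Real.log_one, Finset.sum_add_distrib] at hgibbs
  have hsplit : ∑ p : ι × κ, m.real (B p.1 ∩ C p.2) * Real.log (m.real (B p.1) * m.real (C p.2)) =
      -(∑ i, Real.negMulLog (m.real (B i)) + ∑ j, Real.negMulLog (m.real (C j))) := by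
    have h1 : ∀ p : ι × κ,
        m.real (B p.1 ∩ C p.2) * Real.log (m.real (B p.1) * m.real (C p.2)) =
        m.real (B p.1 ∩ C p.2) * Real.log (m.real (B p.1)) +
        m.real (B p.1 ∩ C p.2) * Real.log (m.real (C p.2)) := by
      intro p
      by_cases hp : m.real (B p.1 ∩ C p.2) = 0
      · simp [hp]
      · rw [Real.log_mul (hpos p hp).1.ne' (hpos p hp).2.ne', mul_add]
    rw [Finset.sum_congr rfl fun p _ => h1 p, Finset.sum_add_distrib, Fintype.sum_prod_type,
      Fintype.sum_prod_type_right]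
    simp only [← Finset.sum_mul]
    rw [Finset.sum_congr rfl fun i _ => by
        rw [hC.sum_measureReal_inter m (hB.measurableSet i)],
      Finset.sum_congr (g := fun j => m.real (C j) * Real.log (m.real (C j))) rfl fun j _ => by
        simp only [inter_comm _ (C j)]
        rw [hB.sum_measureReal_inter m (hC.measurableSet j)]]
    simp only [Real.negMulLog, neg_mul, Finset.sum_neg_distrib]
    ring
  linarith

end IsMeasurablePartition

theorem IsBorelCover.exists_isMeasurablePartition {𝒱 : Finset (Set X)} (h𝒱 : IsBorelCover 𝒱) :
    ∃ B : 𝒱 → Set X, IsMeasurablePartition B ∧ ∀ V, B V ⊆ V := by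
  set e := 𝒱.equivFin
  set f : Fin 𝒱.card → Set X := fun i => (e.symm i : Set X) with hf
  refine ⟨fun V => disjointed f (e V), ⟨fun V => ?_, fun V W hVW => ?_, ?_⟩, fun V => ?_⟩
  · rw [disjointed_eq_inter_compl]
    exact (h𝒱.1 _ (e.symm _).2).inter (MeasurableSet.iInter fun j => MeasurableSet.iInter fun _ =>
      (h𝒱.1 _ (e.symm j).2).compl)
  · exact disjoint_disjointed f (e.injective.ne hVW)
  · rw [e.surjective.iUnion_comp fun i => disjointed f i, iUnion_disjointed, hf,
      e.symm.surjective.iUnion_comp fun V : 𝒱 => (V : Set X), ← h𝒱.2, sUnion_eq_iUnion]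
    rfl
  · simpa [hf] using disjointed_subset f (e V)

theorem IsPartitionF.isMeasurablePartition {α : Finset (Set X)} (hα : IsPartitionF α) :
    IsMeasurablePartition fun A : α => (A : Set X) where
  measurableSet A := hα.1 A A.2
  disjoint A B hAB := hα.2.2 A A.2 B B.2 fun h => hAB (Subtype.ext h)
  iUnion_eq := by
    rw [← hα.2.1, sUnion_eq_iUnion]
    rfl

theorem entF_eq_sum_subtype (m : Measure X) (α : Finset (Set X)) :
    entF m α = ∑ A : α, Real.negMulLog (m.real A) :=
  (Finset.sum_coe_sort α fun A => Real.negMulLog (m.real A)).symm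

theorem entF_nonneg (m : Measure X) [IsProbabilityMeasure m] (α : Finset (Set X)) :
    0 ≤ entF m α :=
  Finset.sum_nonneg fun _ _ => Real.negMulLog_nonneg measureReal_nonneg measureReal_le_one

theorem Hcov_nonneg (m : Measure X) [IsProbabilityMeasure m] (𝒰 : Finset (Set X)) :
    0 ≤ Hcov m 𝒰 := by
  refine Real.sInf_nonneg ?_
  rintro r ⟨α, -, -, rfl⟩
  exact entF_nonneg m α

theorem IsMeasurablePartition.image {ι : Type*} [Fintype ι] {B : ι → Set X}
    (hB : IsMeasurablePartition B) : IsPartitionF (Finset.univ.image B) := by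
  refine ⟨fun A hA => ?_, ?_, fun A hA A' hA' hne => ?_⟩
  · obtain ⟨i, -, rfl⟩ := Finset.mem_image.1 hA
    exact hB.measurableSet i
  · rw [← hB.iUnion_eq]
    simp
  · obtain ⟨i, -, rfl⟩ := Finset.mem_image.1 hA
    obtain ⟨j, -, rfl⟩ := Finset.mem_image.1 hA'
    exact hB.disjoint fun h => hne (by rw [h])

theorem IsMeasurablePartition.entF_image {ι : Type*} [Fintype ι] {B : ι → Set X}
    (hB : IsMeasurablePartition B) (m : Measure X) :
    entF m (Finset.univ.image B) = ∑ i, Real.negMulLog (m.real (B i)) := by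
  refine Finset.sum_image_of_pairwise_eq_zero (g := fun A => Real.negMulLog (m.real A)) ?_
  intro i _ j _ hij heq
  have hd : Disjoint (B i) (B j) := hB.disjoint hij
  rw [← heq, disjoint_self, bot_eq_empty] at hd
  simp [hd]

theorem Hcov_le_sum {ι : Type*} [Fintype ι] {B : ι → Set X} (hB : IsMeasurablePartition B)
    (m : Measure X) [IsProbabilityMeasure m] {𝒰 : Finset (Set X)}
    (hB𝒰 : ∀ i, ∃ U ∈ 𝒰, B i ⊆ U) : Hcov m 𝒰 ≤ ∑ i, Real.negMulLog (m.real (B i)) := by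
  refine csInf_le ⟨0, ?_⟩ ⟨Finset.univ.image B, hB.image, ?_, (hB.entF_image m).symm⟩
  · rintro r ⟨α, -, -, rfl⟩
    exact entF_nonneg m α
  · intro A hA
    obtain ⟨i, -, rfl⟩ := Finset.mem_image.1 hA
    exact hB𝒰 i

theorem IsBorelCover.exists_entF_lt {𝒰 : Finset (Set X)} (h𝒰 : IsBorelCover 𝒰) (m : Measure X)
    {ε : ℝ} (hε : 0 < ε) :
    ∃ α, IsPartitionF α ∧ Refines α 𝒰 ∧ entF m α < Hcov m 𝒰 + ε := by
  obtain ⟨B, hB, hB𝒰⟩ := h𝒰.exists_isMeasurablePartition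
  have hne : {r | ∃ α : Finset (Set X), IsPartitionF α ∧ Refines α 𝒰 ∧ r = entF m α}.Nonempty := by
    refine ⟨_, Finset.univ.image B, hB.image, fun A hA => ?_, rfl⟩
    obtain ⟨V, -, rfl⟩ := Finset.mem_image.1 hA
    exact ⟨V, V.2, hB𝒰 V⟩
  obtain ⟨r, ⟨α, h1, h2, rfl⟩, h3⟩ := exists_lt_of_csInf_lt hne (lt_add_of_pos_right _ hε)
  exact ⟨α, h1, h2, h3⟩

theorem mem_joinF {T : X → X} {𝒰 : Finset (Set X)} {n : ℕ} {W : Set X} :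
    W ∈ joinF T 𝒰 n ↔
      ∃ u : Fin n → Set X, (∀ i, u i ∈ 𝒰) ∧ ⋂ i : Fin n, T^[(i : ℕ)] ⁻¹' u i = W := by
  simp [joinF]

theorem card_joinF_le (T : X → X) (𝒰 : Finset (Set X)) (n : ℕ) :
    (joinF T 𝒰 n).card ≤ 𝒰.card ^ n := by
  refine Finset.card_image_le.trans ?_
  simp [Fintype.card_piFinset]

theorem IsOpenCover.isBorelCover_joinF {T : X → X} (hT : Continuous T) {𝒰 : Finset (Set X)}
    (h𝒰 : IsOpenCover 𝒰) (n : ℕ) : IsBorelCover (joinF T 𝒰 n) := by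
  refine ⟨fun W hW => ?_, eq_univ_iff_forall.2 fun x => ?_⟩
  · obtain ⟨u, hu, rfl⟩ := mem_joinF.1 hW
    exact MeasurableSet.iInter fun i => (hT.iterate i).measurable (h𝒰.1 _ (hu i)).measurableSet
  · have h : ∀ i : Fin n, ∃ U ∈ 𝒰, T^[(i : ℕ)] x ∈ U := fun i =>
      mem_sUnion.1 (h𝒰.2.symm ▸ mem_univ (T^[(i : ℕ)] x))
    choose u hu hxu using h
    exact mem_sUnion.2 ⟨_, mem_joinF.2 ⟨u, hu, rfl⟩, mem_iInter.2 hxu⟩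

theorem exists_mem_joinF_add {T : X → X} {𝒰 : Finset (Set X)} {k n : ℕ} {V W : Set X}
    (hV : V ∈ joinF T 𝒰 k) (hW : W ∈ joinF T 𝒰 n) :
    ∃ U ∈ joinF T 𝒰 (k + n), V ∩ T^[k] ⁻¹' W ⊆ U := by
  obtain ⟨u, hu, rfl⟩ := mem_joinF.1 hV
  obtain ⟨v, hv, rfl⟩ := mem_joinF.1 hW
  refine ⟨_, mem_joinF.2 ⟨Fin.append u v, fun i => ?_, rfl⟩, ?_⟩
  · refine Fin.addCases (fun i => ?_) (fun i => ?_) i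
    · simpa using hu i
    · simpa using hv i
  · rintro x ⟨hx, hx'⟩
    refine mem_iInter.2 fun i => ?_
    refine Fin.addCases (fun i => ?_) (fun i => ?_) i
    · simpa using mem_iInter.1 hx i
    · have h := mem_iInter.1 (mem_preimage.1 hx') i
      rw [mem_preimage, ← Function.iterate_add_apply, add_comm] at h
      simpa using h

theorem subadditive_Hcov {T : X → X} (hT : Continuous T) {𝒰 : Finset (Set X)}
    (h𝒰 : IsOpenCover 𝒰) {m : Measure X} [IsProbabilityMeasure m] (hm : MeasurePreserving T m m) :
    Subadditive fun n => Hcov m (joinF T 𝒰 n) := by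
  intro k n
  refine le_of_forall_pos_le_add fun ε hε => ?_
  obtain ⟨α, hα, hα𝒰, hαε⟩ := (h𝒰.isBorelCover_joinF hT k).exists_entF_lt m (half_pos hε)
  obtain ⟨β, hβ, hβ𝒰, hβε⟩ := (h𝒰.isBorelCover_joinF hT n).exists_entF_lt m (half_pos hε)
  have hA := hα.isMeasurablePartition
  have hB := hβ.isMeasurablePartition.preimage (hT.iterate k).measurable
  have hle := Hcov_le_sum (hA.inter hB) m (𝒰 := joinF T 𝒰 (k + n)) fun p => by
    obtain ⟨V, hV, hpV⟩ := hα𝒰 p.1 p.1.2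
    obtain ⟨W, hW, hpW⟩ := hβ𝒰 p.2 p.2.2
    obtain ⟨U, hU, hVWU⟩ := exists_mem_joinF_add hV hW
    exact ⟨U, hU, (inter_subset_inter hpV (preimage_mono hpW)).trans hVWU⟩
  have hent := hle.trans (hA.entropy_inter_le hB m)
  have hpres : ∀ B : β, m.real (T^[k] ⁻¹' (B : Set X)) = m.real B := fun B =>
    (hm.iterate k).measureReal_preimage (hβ.1 B B.2).nullMeasurableSet
  simp only [hpres, ← entF_eq_sum_subtype] at hent
  linarith

theorem tendsto_hcov {T : X → X} (hT : Continuous T) {𝒰 : Finset (Set X)}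
    (h𝒰 : IsOpenCover 𝒰) {m : Measure X} [IsProbabilityMeasure m] (hm : MeasurePreserving T m m) :
    Tendsto (fun n : ℕ => Hcov m (joinF T 𝒰 n) / n) atTop (nhds (hcov T m 𝒰)) := by
  have h := (subadditive_Hcov hT h𝒰 hm).tendsto_lim ⟨0, by
    rintro _ ⟨n, rfl⟩
    exact div_nonneg (Hcov_nonneg m _) n.cast_nonneg⟩
  rwa [hcov, h.limsup_eq]

theorem wt_pos (T : X → X) (ℰ : ProbabilityMeasure X → ℝ) (n : ℕ) (x : X) : 0 < wt T ℰ n x :=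
  Real.exp_pos _

theorem wt_le_exp {T : X → X} {ℰ : ProbabilityMeasure X → ℝ} {M : ℝ} (hM : ∀ ν, |ℰ ν| ≤ M)
    (n : ℕ) (x : X) : wt T ℰ n x ≤ Real.exp (n * M) :=
  Real.exp_le_exp.2 (mul_le_mul_of_nonneg_left ((le_abs_self _).trans (hM _)) n.cast_nonneg)

theorem sSup_wt_nonneg (T : X → X) (ℰ : ProbabilityMeasure X → ℝ) (n : ℕ) (V : Set X) :
    0 ≤ sSup (wt T ℰ n '' V) := by
  refine Real.sSup_nonneg ?_
  rintro _ ⟨x, -, rfl⟩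
  exact (wt_pos T ℰ n x).le

theorem wt_le_sSup {T : X → X} {ℰ : ProbabilityMeasure X → ℝ} (hE : Continuous ℰ) (n : ℕ)
    {V : Set X} {x : X} (hx : x ∈ V) : wt T ℰ n x ≤ sSup (wt T ℰ n '' V) := by
  obtain ⟨M, -, hM⟩ := exists_abs_energy_le hE
  refine le_csSup ⟨Real.exp (n * M), ?_⟩ (mem_image_of_mem _ hx)
  rintro _ ⟨y, -, rfl⟩
  exact wt_le_exp hM n y

/-- Entropy plus mean energy is bounded by the log-weight of any Borel cover refining the join. -/
theorem Hcov_add_integral_le_log_sum {T : X → X} (hT : Continuous T)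
    {ℰ : ProbabilityMeasure X → ℝ} (hE : Continuous ℰ) {𝒰 𝒱 : Finset (Set X)} {n : ℕ}
    (h𝒱 : IsBorelCover 𝒱) (hr : Refines 𝒱 (joinF T 𝒰 n)) (μ : ProbabilityMeasure X) :
    Hcov (μ : Measure X) (joinF T 𝒰 n) + n * ∫ x, ℰ (empPM T n x) ∂(μ : Measure X) ≤
      Real.log (∑ V ∈ 𝒱, sSup (wt T ℰ n '' V)) := by
  obtain ⟨B, hB, hB𝒱⟩ := h𝒱.exists_isMeasurablePartition
  have hent := Hcov_le_sum hB (μ : Measure X) (𝒰 := joinF T 𝒰 n) fun V => by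
    obtain ⟨W, hW, hVW⟩ := hr V V.2
    exact ⟨W, hW, (hB𝒱 V).trans hVW⟩
  have hint := integrable_energy_empPM hT hE μ n
  have henergy : n * ∫ x, ℰ (empPM T n x) ∂(μ : Measure X) ≤
      ∑ V : 𝒱, (μ : Measure X).real (B V) * Real.log (sSup (wt T ℰ n '' V)) := by
    rw [← integral_const_mul, ← setIntegral_univ, ← hB.iUnion_eq,
      integral_iUnion_fintype hB.measurableSet hB.disjoint
        fun V => (hint.const_mul _).integrableOn]
    refine Finset.sum_le_sum fun V _ => ?_
    rw [← smul_eq_mul ((μ : Measure X).real _), ← setIntegral_const]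
    refine setIntegral_mono_on (hint.const_mul _).integrableOn integrableOn_const
      (hB.measurableSet V) fun x hx => ?_
    have hle := wt_le_sSup (T := T) hE n (hB𝒱 V hx)
    exact (Real.le_log_iff_exp_le ((wt_pos T ℰ n x).trans_le hle)).2 hle
  have hgibbs := sum_negMulLog_add_mul_log_le
    (b := fun V : 𝒱 => (μ : Measure X).real (B V)) (w := fun V => sSup (wt T ℰ n '' V))
    (fun V => measureReal_nonneg) (hB.sum_measureReal (μ : Measure X))
    (fun V => sSup_wt_nonneg T ℰ n V) (fun V hV => by
      obtain ⟨x, hx⟩ := nonempty_of_measureReal_ne_zero hV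
      exact (wt_pos T ℰ n x).trans_le (wt_le_sSup hE n (hB𝒱 V hx)))
  rw [Finset.sum_add_distrib, Finset.sum_coe_sort 𝒱 fun V => sSup (wt T ℰ n '' V)] at hgibbs
  linarith

theorem IsBorelCover.sum_sSup_wt_pos [Nonempty X] {T : X → X} {ℰ : ProbabilityMeasure X → ℝ}
    (hE : Continuous ℰ) {𝒱 : Finset (Set X)} (h𝒱 : IsBorelCover 𝒱) (n : ℕ) :
    0 < ∑ V ∈ 𝒱, sSup (wt T ℰ n '' V) := by
  obtain ⟨x⟩ := ‹Nonempty X›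
  obtain ⟨V, hV, hx⟩ := mem_sUnion.1 (h𝒱.2.symm ▸ mem_univ x)
  exact Finset.sum_pos' (fun V _ => sSup_wt_nonneg T ℰ n V)
    ⟨V, hV, (wt_pos T ℰ n x).trans_le (wt_le_sSup hE n hx)⟩

theorem exp_Hcov_add_integral_le_p1 {T : X → X} (hT : Continuous T)
    {ℰ : ProbabilityMeasure X → ℝ} (hE : Continuous ℰ) {𝒰 : Finset (Set X)}
    (h𝒰 : IsOpenCover 𝒰) (μ : ProbabilityMeasure X) (n : ℕ) :
    Real.exp (Hcov (μ : Measure X) (joinF T 𝒰 n) +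
      n * ∫ x, ℰ (empPM T n x) ∂(μ : Measure X)) ≤ p1 T ℰ 𝒰 n := by
  have : Nonempty X := μ.nonempty
  refine le_csInf ⟨_, joinF T 𝒰 n, h𝒰.isBorelCover_joinF hT n,
    fun V hV => ⟨V, hV, Subset.rfl⟩, rfl⟩ ?_
  rintro r ⟨𝒱, h𝒱, hr, rfl⟩
  exact (Real.le_log_iff_exp_le (h𝒱.sum_sSup_wt_pos hE n)).1
    (Hcov_add_integral_le_log_sum hT hE h𝒱 hr μ)

theorem p1_le {T : X → X} (hT : Continuous T) {ℰ : ProbabilityMeasure X → ℝ} {M : ℝ}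
    (hM : ∀ ν, |ℰ ν| ≤ M) {𝒰 : Finset (Set X)} (h𝒰 : IsOpenCover 𝒰) (n : ℕ) :
    p1 T ℰ 𝒰 n ≤ (𝒰.card : ℝ) ^ n * Real.exp (n * M) := by
  have h1 : p1 T ℰ 𝒰 n ≤ ∑ V ∈ joinF T 𝒰 n, sSup (wt T ℰ n '' V) := by
    refine csInf_le ⟨0, ?_⟩ ⟨joinF T 𝒰 n, h𝒰.isBorelCover_joinF hT n,
      fun V hV => ⟨V, hV, Subset.rfl⟩, rfl⟩
    rintro r ⟨𝒱, -, -, rfl⟩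
    exact Finset.sum_nonneg fun V _ => sSup_wt_nonneg T ℰ n V
  have h2 : ∑ V ∈ joinF T 𝒰 n, sSup (wt T ℰ n '' V) ≤
      (joinF T 𝒰 n).card • Real.exp (n * M) := by
    refine Finset.sum_le_card_nsmul _ _ _ fun V _ => Real.sSup_le ?_ (Real.exp_pos _).le
    rintro _ ⟨x, -, rfl⟩
    exact wt_le_exp hM n x
  refine (h1.trans h2).trans ?_
  rw [nsmul_eq_mul]
  exact mul_le_mul_of_nonneg_right (mod_cast card_joinF_le T 𝒰 n) (Real.exp_pos _).le

/-- for every ergodic measure `μ`,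
`h_μ(T,𝒰) + ℰ(μ) ≤ liminf (1/n) log p_n(T,ℰ;𝒰)`. -/
theorem ergodic_le_lower_pressure (T : X → X) (hT : Continuous T)
    (ℰ : ProbabilityMeasure X → ℝ) (hE : Continuous ℰ)
    (𝒰 : Finset (Set X)) (h𝒰 : IsOpenCover 𝒰)
    (μ : ProbabilityMeasure X) (herg : Ergodic T (μ : Measure X)) :
    hcov T (μ : Measure X) 𝒰 + ℰ μ ≤
      Filter.atTop.liminf fun n => Real.log (p1 T ℰ 𝒰 n) / n := by
  obtain ⟨M, hM0, hM⟩ := exists_abs_energy_le hE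
  have hlower := exp_Hcov_add_integral_le_p1 hT hE h𝒰 μ
  have hpos : ∀ n, 0 < p1 T ℰ 𝒰 n := fun n => (Real.exp_pos _).trans_le (hlower n)
  have hbdd : IsBoundedUnder (· ≤ ·) atTop fun n : ℕ => Real.log (p1 T ℰ 𝒰 n) / n := by
    refine isBoundedUnder_of_eventually_le (a := Real.log 𝒰.card + M) ?_
    filter_upwards [eventually_gt_atTop 0] with n hn
    have hle := p1_le hT hM h𝒰 n
    have hcard : (𝒰.card : ℝ) ^ n ≠ 0 := by
      intro h
      rw [h, zero_mul] at hle
      exact (hpos n).not_ge hle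
    have hlog := Real.log_le_log (hpos n) hle
    rw [Real.log_mul hcard (Real.exp_pos _).ne', Real.log_exp, Real.log_pow] at hlog
    rw [div_le_iff₀ (by exact_mod_cast hn)]
    linarith
  refine le_of_forall_pos_le_add fun ε hε => ?_
  rw [← sub_le_iff_le_add]
  refine le_liminf_of_le hbdd.isCoboundedUnder_ge ?_
  have hent := (tendsto_hcov hT h𝒰 herg.toMeasurePreserving).eventually
    (lt_mem_nhds (sub_lt_self _ (half_pos hε)))
  filter_upwards [eventually_gt_atTop 0, hent,
    eventually_le_integral_energy hT hE herg (half_pos hε)] with n hn hn1 hn2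
  have hn0 : (0 : ℝ) < n := by exact_mod_cast hn
  have hlog := (Real.le_log_iff_exp_le (hpos n)).2 (hlower n)
  rw [lt_div_iff₀ hn0] at hn1
  rw [le_div_iff₀ hn0]
  have := mul_le_mul_of_nonneg_left hn2 hn0.le
  linarith
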